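/- arXiv:math/0007152 — 4 statements merged into one kernel-verified Lean document; each statement's English description precedes it below -/
import Mathlib

section
/- The group G₁ with presentation ⟨a, b | a²(ab)² = 1, ab²a⁻¹b⁻² = 1⟩ and the group G₂ with presentation ⟨a, b | b² = (ab)⁴⟩ are not isomorphic. -/
noncomputable section

/-- generator a of the free group on two generators -/
def ga : FreeGroup (Fin 2) := FreeGroup.of 0
/-- generator b of the free group on two generators -/
def gb : FreeGroup (Fin 2) := FreeGroup.of 1

/-- relators of G₁: a²(ab)² and ab²a⁻¹b⁻² -/
def rels1 : Set (FreeGroup (Fin 2)) := {ga ^ 2 * (ga * gb) ^ 2, ga * gb ^ 2 * ga⁻¹ * (gb ^ 2)⁻¹}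

/-- the group G₁ = ⟨a, b | a²(ab)² = 1, ab²a⁻¹b⁻² = 1⟩ -/
abbrev G1 := PresentedGroup rels1

/-- relator of G₂: b²((ab)⁴)⁻¹, i.e. the relation b² = (ab)⁴ -/
def rels2 : Set (FreeGroup (Fin 2)) := {gb ^ 2 * ((ga * gb) ^ 4)⁻¹}

/-- the group G₂ = ⟨a, b | b² = (ab)⁴⟩ -/
abbrev G2 := PresentedGroup rels2

/-- If two commuting elements of order dividing two generate a group, every element squares to 1. -/
theorem sq_eq_one_of_closure_pair {Q : Type*} [Group Q] {a b : Q}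
    (hgen : Subgroup.closure {a, b} = ⊤) (ha : a ^ 2 = 1) (hb : b ^ 2 = 1)
    (hab : Commute a b) (x : Q) : x ^ 2 = 1 := by
  have hcomm : ∀ z w : Q, Commute z w := by
    have key : ∀ c : Q, Commute a c → Commute b c → ∀ z : Q, Commute z c := by
      intro c hac hbc z
      have hz : z ∈ Subgroup.closure {a, b} := hgen ▸ Subgroup.mem_top z
      induction hz using Subgroup.closure_induction with
      | mem y hy =>
        rcases hy with rfl | rfl
        exacts [hac, hbc]
      | one => exact Commute.one_left c
      | mul y z _ _ hy hz => exact hy.mul_left hz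
      | inv y _ hy => exact hy.inv_left
    exact fun z w => key w (key a (Commute.refl a) hab.symm w).symm
      (key b hab (Commute.refl b) w).symm z
  have hx : x ∈ Subgroup.closure {a, b} := hgen ▸ Subgroup.mem_top x
  induction hx using Subgroup.closure_induction with
  | mem y hy =>
    rcases hy with rfl | rfl
    exacts [ha, hb]
  | one => exact one_pow 2
  | mul y z _ _ hy hz => rw [(hcomm y z).mul_pow, hy, hz, one_mul]
  | inv y _ hy => rw [inv_pow, hy, inv_one]

theorem mem_center_of_closure_pair {G : Type*} [Group G] {a b z : G}
    (hgen : Subgroup.closure {a, b} = ⊤) (ha : Commute a z) (hb : Commute b z) :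
    z ∈ Subgroup.center G := by
  rw [Subgroup.mem_center_iff]
  intro g
  have hg : g ∈ Subgroup.closure {a, b} := hgen ▸ Subgroup.mem_top g
  have hle : Subgroup.closure {a, b} ≤ Subgroup.centralizer {z} := by
    rw [Subgroup.closure_le]
    rintro y (rfl | rfl) <;> rw [SetLike.mem_coe, Subgroup.mem_centralizer_singleton_iff]
    exacts [ha, hb]
  exact Subgroup.mem_centralizer_singleton_iff.mp (hle hg)

/-- In a group generated by `a, b` subject to the relations of `G1`, all squares are central. -/
theorem sq_mem_center_of_relations {G : Type*} [Group G] {a b : G}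
    (hgen : Subgroup.closure {a, b} = ⊤) (h₁ : a ^ 2 * (a * b) ^ 2 = 1)
    (h₂ : a * b ^ 2 * a⁻¹ * (b ^ 2)⁻¹ = 1) (x : G) : x ^ 2 ∈ Subgroup.center G := by
  have hbc : b ^ 2 ∈ Subgroup.center G :=
    mem_center_of_closure_pair hgen (mul_inv_eq_iff_eq_mul.mp (mul_inv_eq_one.mp h₂))
      (Commute.self_pow b 2)
  have hac : a ^ 2 ∈ Subgroup.center G := by
    refine mem_center_of_closure_pair hgen (Commute.self_pow a 2) ?_
    have hc : Commute (a * b) (a ^ 2) := by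
      rw [eq_inv_of_mul_eq_one_left h₁]
      exact (Commute.self_pow (a * b) 2).inv_right
    have := (Commute.self_pow a 2).inv_left.mul_left hc
    rwa [inv_mul_cancel_left] at this
  let π := QuotientGroup.mk' (Subgroup.center G)
  have hker : ∀ g : G, g ∈ Subgroup.center G ↔ π g = 1 :=
    fun g => (QuotientGroup.eq_one_iff g).symm
  have hgen' : Subgroup.closure {π a, π b} = ⊤ := by
    rw [← Set.image_pair, ← MonoidHom.map_closure, hgen]
    exact Subgroup.map_top_of_surjective π (QuotientGroup.mk'_surjective _)
  have ha : π a ^ 2 = 1 := by rw [← map_pow]; exact (hker _).mp hac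
  have hb : π b ^ 2 = 1 := by rw [← map_pow]; exact (hker _).mp hbc
  have hab : (π a * π b) ^ 2 = 1 := by
    have := congrArg π h₁
    rwa [map_mul, map_pow, map_pow, map_mul, map_one, ha, one_mul] at this
  have hcomm : Commute (π a) (π b) := by
    rw [sq, mul_eq_one_iff_eq_inv] at ha hb hab
    rw [mul_inv_rev, ← ha, ← hb] at hab
    exact hab
  rw [hker, map_pow]
  exact sq_eq_one_of_closure_pair hgen' ha hb hcomm (π x)

theorem G1_sq_mem_center (x : G1) : x ^ 2 ∈ Subgroup.center G1 := by
  refine sq_mem_center_of_relations (a := PresentedGroup.mk rels1 ga)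
    (b := PresentedGroup.mk rels1 gb) ?_ ?_ ?_ x
  · rw [← PresentedGroup.closure_range_of rels1]
    congr 1
    ext y
    simp [Fin.exists_fin_two, PresentedGroup.of, ga, gb, eq_comm]
  · simpa using PresentedGroup.one_of_mem (rels := rels1) (Or.inl rfl)
  · simpa using PresentedGroup.one_of_mem (rels := rels1) (Or.inr rfl)

/-- A homomorphism from `G2` to the symmetric group on four letters, sending `b` to a transposition
and `a * b` to a four-cycle. -/
def G2ToPerm : G2 →* Equiv.Perm (Fin 4) :=
  PresentedGroup.toGroup (rels := rels2)
    (f := ![finRotate 4 * Equiv.swap 0 1, Equiv.swap 0 1]) (by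
      rintro r rfl
      simp only [ga, gb, map_mul, map_inv, map_pow, FreeGroup.lift_apply_of]
      decide)

theorem G2_exists_sq_notMem_center : ∃ x : G2, x ^ 2 ∉ Subgroup.center G2 := by
  refine ⟨PresentedGroup.of 0 * PresentedGroup.of 1, fun h => ?_⟩
  have h' := congrArg G2ToPerm (Subgroup.mem_center_iff.mp h (PresentedGroup.of 1))
  simp only [G2ToPerm, map_mul, map_pow, PresentedGroup.toGroup.of] at h'
  revert h'
  decide

/-- The groups G₁ = ⟨a, b | a²(ab)² = 1, ab²a⁻¹b⁻² = 1⟩ and G₂ = ⟨a, b | b² = (ab)⁴⟩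
are not isomorphic. -/
theorem stmt_0 : IsEmpty (G1 ≃* G2) := by
  refine ⟨fun e => ?_⟩
  obtain ⟨x, hx⟩ := G2_exists_sq_notMem_center
  refine hx (Subgroup.mem_center_iff.mpr fun g => e.symm.injective ?_)
  simpa only [map_mul, map_pow] using
    Subgroup.mem_center_iff.mp (G1_sq_mem_center (e.symm x)) (e.symm g)
end
end

section
/- The abelianization of the group G₁ with presentation ⟨a, b | a²(ab)² = 1, ab²a⁻¹b⁻² = 1⟩ is isomorphic to ℤ × ℤ/2ℤ. -/
noncomputable section

/-- The images of the generators of `G1` in `ℤ × ZMod 2`. -/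
def G1.genImage : Fin 2 → Multiplicative (ℤ × ZMod 2) :=
  ![Multiplicative.ofAdd (1, 0), Multiplicative.ofAdd (-2, 1)]

theorem G1.lift_genImage_eq_one : ∀ r ∈ rels1, FreeGroup.lift G1.genImage r = 1 := by
  rintro r (rfl | rfl)
  · simp only [ga, gb, map_mul, map_pow, FreeGroup.lift_apply_of]
    decide
  · simp [ga, gb]

/-- The homomorphism `a ↦ (1, 0)`, `b ↦ (-2, 1)` on the abelianization of `G1`. -/
def G1.abelianizationHom : Additive (Abelianization G1) →+ ℤ × ZMod 2 :=
  MonoidHom.toAdditiveLeft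
    (Abelianization.lift (PresentedGroup.toGroup G1.lift_genImage_eq_one))

/-- The class of the `i`-th generator in the abelianization of `G1`. -/
def G1.abGen (i : Fin 2) : Additive (Abelianization G1) :=
  Additive.ofMul (Abelianization.of (PresentedGroup.of i))

theorem G1.two_nsmul_abGen : 2 • (2 • G1.abGen 0 + G1.abGen 1) = 0 := by
  have h : (PresentedGroup.mk rels1) (ga ^ 2 * (ga * gb) ^ 2) = 1 :=
    PresentedGroup.one_of_mem (Or.inl rfl)
  have h' : 2 • G1.abGen 0 + 2 • (G1.abGen 0 + G1.abGen 1) = 0 :=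
    congrArg (fun x => Additive.ofMul (Abelianization.of x)) h
  rw [← h']
  abel

/-- The homomorphism `(1, 0) ↦ a`, `(0, 1) ↦ a²b` into the abelianization of `G1`. -/
def G1.abelianizationInv : ℤ × ZMod 2 →+ Additive (Abelianization G1) :=
  (zmultiplesHom _ (G1.abGen 0)).coprod
    (ZMod.lift 2 ⟨zmultiplesHom _ (2 • G1.abGen 0 + G1.abGen 1), by
      exact (natCast_zsmul _ 2).trans G1.two_nsmul_abGen⟩)

theorem G1.abelianizationHom_abGen (i : Fin 2) :
    G1.abelianizationHom (G1.abGen i) = (G1.genImage i).toAdd := by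
  simp [G1.abelianizationHom, G1.abGen]

theorem G1.abelianizationInv_apply (m n : ℤ) :
    G1.abelianizationInv (m, (n : ZMod 2)) =
      m • G1.abGen 0 + n • (2 • G1.abGen 0 + G1.abGen 1) := by
  simp [G1.abelianizationInv]

theorem G1.abelianizationInv_genImage (i : Fin 2) :
    G1.abelianizationInv (G1.genImage i).toAdd = G1.abGen i := by
  fin_cases i
  · simpa [G1.genImage] using G1.abelianizationInv_apply 1 0
  · have h := G1.abelianizationInv_apply (-2) 1
    rw [Int.cast_one] at h
    refine h.trans ?_
    simp only [Fin.mk_one]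
    module

theorem G1.abelianizationInv_comp_hom :
    G1.abelianizationInv.comp G1.abelianizationHom = AddMonoidHom.id _ := by
  apply MonoidHom.toAdditive.symm.injective
  ext i
  exact (congrArg G1.abelianizationInv (G1.abelianizationHom_abGen i)).trans
    (G1.abelianizationInv_genImage i)

theorem G1.abelianizationHom_comp_inv :
    G1.abelianizationHom.comp G1.abelianizationInv = AddMonoidHom.id _ := by
  ext1 ⟨m, z⟩
  obtain ⟨n, rfl⟩ := ZMod.intCast_surjective z
  rw [AddMonoidHom.comp_apply, G1.abelianizationInv_apply]
  simp [G1.abelianizationHom_abGen, G1.genImage]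

/-- The abelianization of G₁ = ⟨a, b | a²(ab)² = 1, ab²a⁻¹b⁻² = 1⟩ is isomorphic
to ℤ × ℤ/2ℤ. -/
theorem stmt_1 : Nonempty (Additive (Abelianization G1) ≃+ ℤ × ZMod 2) :=
  ⟨G1.abelianizationHom.toAddEquiv G1.abelianizationInv G1.abelianizationInv_comp_hom
    G1.abelianizationHom_comp_inv⟩
end
end

section
/- The commutator subgroup of the group G₁ with presentation ⟨a, b | a²(ab)² = 1, ab²a⁻¹b⁻² = 1⟩ has exactly two elements and is contained in the center of G₁; in particular G₁ is a central extension of ℤ/2ℤ by ℤ × ℤ/2ℤ. -/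
noncomputable section

open scoped commutatorElement

section Relators

variable {G : Type*} [Group G] {x y : G}

theorem commute_sq_of_relator (h : x ^ 2 * (x * y) ^ 2 = 1) : Commute (x ^ 2) y := by
  have h1 : Commute (x ^ 2) (x * y) := by
    rw [eq_inv_of_mul_eq_one_left h]
    exact ((Commute.refl (x * y)).pow_left 2).inv_left
  have h2 : Commute (x ^ 2) x⁻¹ := ((Commute.refl x).pow_left 2).inv_right
  simpa using h2.mul_right h1

theorem commutatorElement_eq_of_relators (h : x ^ 2 * (x * y) ^ 2 = 1)
    (h' : Commute x (y ^ 2)) : ⁅x, y⁆ = x ^ 4 * y ^ 2 := by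
  have hyx : (y * x)⁻¹ = y * x ^ 3 := by
    rw [inv_eq_iff_mul_eq_one]
    calc y * x * (y * x ^ 3) = (x ^ 3)⁻¹ * (x ^ 2 * (x * y) ^ 2) * x ^ 3 := by
          simp only [pow_succ, pow_zero]; group
      _ = 1 := by rw [h]; group
  calc ⁅x, y⁆ = x * y * (y * x)⁻¹ := by rw [commutatorElement_def]; group
    _ = x * y ^ 2 * x ^ 3 := by rw [hyx]; simp only [pow_two, mul_assoc]
    _ = x * (x ^ 3 * y ^ 2) := by rw [mul_assoc, (h'.pow_left 3).eq]
    _ = x ^ 4 * y ^ 2 := by rw [pow_succ' x 3, mul_assoc]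

theorem commute_commutatorElement_left_of_relators (h : x ^ 2 * (x * y) ^ 2 = 1)
    (h' : Commute x (y ^ 2)) : Commute x ⁅x, y⁆ := by
  rw [commutatorElement_eq_of_relators h h']
  exact ((Commute.refl x).pow_right 4).mul_right h'

theorem commute_commutatorElement_right_of_relators (h : x ^ 2 * (x * y) ^ 2 = 1)
    (h' : Commute x (y ^ 2)) : Commute y ⁅x, y⁆ := by
  rw [commutatorElement_eq_of_relators h h', show x ^ 4 = (x ^ 2) ^ 2 from pow_mul x 2 2]
  exact ((commute_sq_of_relator h).symm.pow_right 2).mul_right ((Commute.refl y).pow_right 2)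

theorem commutatorElement_sq_of_relators (h : x ^ 2 * (x * y) ^ 2 = 1)
    (h' : Commute x (y ^ 2)) : ⁅x, y⁆ ^ 2 = 1 := by
  have hc := (commute_commutatorElement_left_of_relators h h').eq
  have hconj : x * y = ⁅x, y⁆ * (y * x) := by rw [commutatorElement_def]; group
  have h1 : x ^ 2 * y = ⁅x, y⁆ ^ 2 * (y * x ^ 2) :=
    calc x ^ 2 * y = x * (x * y) := by rw [pow_two, mul_assoc]
      _ = x * ⁅x, y⁆ * y * x := by rw [hconj]; simp only [mul_assoc]
      _ = ⁅x, y⁆ * (x * y) * x := by rw [hc]; simp only [mul_assoc]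
      _ = ⁅x, y⁆ * (⁅x, y⁆ * (y * x)) * x := by rw [← hconj]
      _ = ⁅x, y⁆ ^ 2 * (y * x ^ 2) := by simp only [pow_two, mul_assoc]
  rw [(commute_sq_of_relator h).eq] at h1
  exact right_eq_mul.mp h1

end Relators

section Generators

variable {G : Type*} [Group G]

theorem mem_center_of_closure_eq_top {s : Set G} (hs : Subgroup.closure s = ⊤) {c : G}
    (hc : ∀ g ∈ s, Commute g c) : c ∈ Subgroup.center G := by
  rw [← Subgroup.centralizer_univ, ← Subgroup.coe_top, ← hs, Subgroup.centralizer_closure,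
    Subgroup.mem_centralizer_iff]
  exact hc

/-- In a group generated by two elements whose commutator is central, the commutator subgroup
is cyclic, generated by that commutator. -/
theorem commutator_eq_zpowers {x y : G} (hs : Subgroup.closure {x, y} = ⊤)
    (hc : ⁅x, y⁆ ∈ Subgroup.center G) : commutator G = Subgroup.zpowers ⁅x, y⁆ := by
  have hle : Subgroup.zpowers ⁅x, y⁆ ≤ Subgroup.center G := by simpa using hc
  have hN : (Subgroup.zpowers ⁅x, y⁆).Normal :=
    ⟨fun n hn g => by rwa [Subgroup.mem_center_iff.mp (hle hn) g, mul_inv_cancel_right]⟩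
  apply le_antisymm
  · rw [← Subgroup.Normal.quotient_commutative_iff_commutator_le]
    have hxy : Commute (x : G ⧸ Subgroup.zpowers ⁅x, y⁆) y := by
      rw [← commutatorElement_eq_one_iff_commute]
      exact (QuotientGroup.eq_one_iff _).mpr (Subgroup.mem_zpowers _)
    have hgen : Subgroup.closure {(x : G ⧸ Subgroup.zpowers ⁅x, y⁆), ↑y} = ⊤ := by
      have := congrArg (Subgroup.map (QuotientGroup.mk' (Subgroup.zpowers ⁅x, y⁆))) hs
      rw [MonoidHom.map_closure, Set.image_pair, Subgroup.map_top_of_surjective _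
        (QuotientGroup.mk'_surjective _)] at this
      exact this
    have hcomm := Subgroup.isMulCommutative_closure
      (k := {(x : G ⧸ Subgroup.zpowers ⁅x, y⁆), ↑y}) (by
        rintro _ (rfl | rfl) _ (rfl | rfl)
        exacts [rfl, hxy.eq, hxy.eq.symm, rfl])
    rw [hgen] at hcomm
    exact ⟨⟨fun g h => congrArg Subtype.val
      (hcomm.is_comm.comm ⟨g, Subgroup.mem_top g⟩ ⟨h, Subgroup.mem_top h⟩)⟩⟩
  · rw [Subgroup.zpowers_le]
    exact Subgroup.commutator_mem_commutator (Subgroup.mem_top x) (Subgroup.mem_top y)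

end Generators

namespace G1

/-- The image of the generator `a` in `G1`. -/
def x : G1 := PresentedGroup.of 0
/-- The image of the generator `b` in `G1`. -/
def y : G1 := PresentedGroup.of 1

theorem relator_sq : x ^ 2 * (x * y) ^ 2 = 1 :=
  PresentedGroup.one_of_mem (rels := rels1) (x := ga ^ 2 * (ga * gb) ^ 2) (Or.inl rfl)

theorem commute_y_sq : Commute x (y ^ 2) := by
  have h : x * y ^ 2 * x⁻¹ * (y ^ 2)⁻¹ = 1 :=
    PresentedGroup.one_of_mem (rels := rels1) (x := ga * gb ^ 2 * ga⁻¹ * (gb ^ 2)⁻¹) (Or.inr rfl)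
  exact commutatorElement_eq_one_iff_commute.mp h

theorem closure_generators : Subgroup.closure {x, y} = (⊤ : Subgroup G1) := by
  rw [← PresentedGroup.closure_range_of rels1]
  congr 1
  ext g
  simp [Fin.exists_fin_two, x, y, eq_comm]

theorem commutatorElement_mem_center : ⁅x, y⁆ ∈ Subgroup.center G1 := by
  apply mem_center_of_closure_eq_top closure_generators
  rintro g (rfl | rfl)
  · exact commute_commutatorElement_left_of_relators relator_sq commute_y_sq
  · exact commute_commutatorElement_right_of_relators relator_sq commute_y_sq

/-- The homomorphism from `G1` given by a pair of elements satisfying the relations. -/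
def lift {H : Type*} [Group H] (u v : H) (h : u ^ 2 * (u * v) ^ 2 = 1)
    (h' : u * v ^ 2 * u⁻¹ * (v ^ 2)⁻¹ = 1) : G1 →* H :=
  PresentedGroup.toGroup (f := ![u, v]) (by
    rintro r (rfl | rfl)
    · simpa [ga, gb] using h
    · simpa [ga, gb] using h')

section Lift

variable {H : Type*} [Group H] {u v : H} (h : u ^ 2 * (u * v) ^ 2 = 1)
  (h' : u * v ^ 2 * u⁻¹ * (v ^ 2)⁻¹ = 1)

@[simp]
theorem lift_x : lift u v h h' x = u := PresentedGroup.toGroup.of _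

@[simp]
theorem lift_y : lift u v h h' y = v := PresentedGroup.toGroup.of _

end Lift

theorem commutatorElement_ne_one : ⁅x, y⁆ ≠ 1 := by
  intro h
  have := congrArg (lift (QuaternionGroup.a 1 : QuaternionGroup 2) (QuaternionGroup.xa 0)
    (by decide) (by decide)) h
  rw [map_commutatorElement, lift_x, lift_y, map_one] at this
  revert this
  decide

theorem orderOf_commutatorElement : orderOf ⁅x, y⁆ = 2 :=
  orderOf_eq_prime (commutatorElement_sq_of_relators relator_sq commute_y_sq)
    commutatorElement_ne_one

theorem commutator_eq : commutator G1 = Subgroup.zpowers ⁅x, y⁆ :=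
  commutator_eq_zpowers closure_generators commutatorElement_mem_center

/-- The additive hom `Additive (Abelianization G1) →+ ℤ × ZMod 2` with `a ↦ (1, 0)` and
`b ↦ (-2, 1)`. -/
def abelianizationHom_s2 : Additive (Abelianization G1) →+ ℤ × ZMod 2 :=
  MonoidHom.toAdditiveLeft (Abelianization.lift
    (lift (Multiplicative.ofAdd ((1, 0) : ℤ × ZMod 2)) (Multiplicative.ofAdd (-2, 1))
      (by decide) (by decide)))

/-- The class of `a` in the abelianization of `G1`. -/
def abX : Additive (Abelianization G1) := Additive.ofMul (Abelianization.of x)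
/-- The class of `b` in the abelianization of `G1`. -/
def abY : Additive (Abelianization G1) := Additive.ofMul (Abelianization.of y)

@[simp]
theorem abelianizationHom_abX : abelianizationHom_s2 abX = (1, 0) := by
  simp [abelianizationHom_s2, abX]

@[simp]
theorem abelianizationHom_abY : abelianizationHom_s2 abY = (-2, 1) := by
  simp [abelianizationHom_s2, abY]

theorem two_zsmul_eq_zero : (2 : ℤ) • ((2 : ℤ) • abX + abY) = 0 := by
  have h : (2 : ℕ) • abX + (2 : ℕ) • (abX + abY) = 0 :=
    congrArg (fun g => Additive.ofMul (Abelianization.of g)) relator_sq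
  rw [← h]
  module

/-- The inverse of `abelianizationHom`. -/
def abelianizationInv_s2 : ℤ × ZMod 2 →+ Additive (Abelianization G1) :=
  (zmultiplesHom _ abX).coprod
    (ZMod.lift 2 ⟨zmultiplesHom _ ((2 : ℤ) • abX + abY), two_zsmul_eq_zero⟩)

theorem abelianizationInv_apply_s2 (n m : ℤ) :
    abelianizationInv_s2 (n, (m : ZMod 2)) = n • abX + m • ((2 : ℤ) • abX + abY) := by
  simp [abelianizationInv_s2]

theorem abelianizationInv_comp_abelianizationHom :
    abelianizationInv_s2.comp abelianizationHom_s2 = AddMonoidHom.id _ := by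
  have hx : abelianizationInv_s2 (abelianizationHom_s2 abX) = abX := by
    simpa using abelianizationInv_apply_s2 1 0
  have hy : abelianizationInv_s2 (abelianizationHom_s2 abY) = abY := by
    have h := abelianizationInv_apply_s2 (-2) 1
    rw [Int.cast_one] at h
    rw [abelianizationHom_abY, h]
    module
  apply AddMonoidHom.toMultiplicative.injective
  apply Abelianization.hom_ext
  apply PresentedGroup.ext
  rw [Fin.forall_fin_two]
  exact ⟨congrArg Multiplicative.ofAdd hx, congrArg Multiplicative.ofAdd hy⟩

theorem abelianizationHom_comp_abelianizationInv :
    abelianizationHom_s2.comp abelianizationInv_s2 = AddMonoidHom.id _ := by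
  refine AddMonoidHom.ext fun ⟨n, m⟩ => ?_
  obtain ⟨k, rfl⟩ := ZMod.intCast_surjective m
  simp [abelianizationInv_apply_s2]

end G1

/-- The commutator subgroup of G₁ = ⟨a, b | a²(ab)² = 1, ab²a⁻¹b⁻² = 1⟩ has exactly two
elements and is contained in the center of G₁; in particular G₁ is a central extension of
ℤ/2ℤ by ℤ × ℤ/2ℤ (the quotient by the commutator subgroup being ℤ × ℤ/2ℤ). -/
theorem stmt_2 :
    Nat.card (commutator G1) = 2 ∧ commutator G1 ≤ Subgroup.center G1 ∧
      Nonempty (Additive (Abelianization G1) ≃+ ℤ × ZMod 2) := by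
  refine ⟨?_, ?_, ⟨AddMonoidHom.toAddEquiv G1.abelianizationHom_s2 G1.abelianizationInv_s2
    G1.abelianizationInv_comp_abelianizationHom G1.abelianizationHom_comp_abelianizationInv⟩⟩
  · rw [G1.commutator_eq, Nat.card_zpowers, G1.orderOf_commutatorElement]
  · rw [G1.commutator_eq, Subgroup.zpowers_le]
    exact G1.commutatorElement_mem_center
end
end

section
/- The commutator subgroup of the group G₂ with presentation ⟨a, b | b² = (ab)⁴⟩ is isomorphic to the free group on three generators; in particular G₂ is an extension of the free group of rank 3 by ℤ × ℤ/2ℤ. -/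
noncomputable section

namespace G2

open Equiv

/-- The generator `b` of `G2`. -/
def b : G2 := PresentedGroup.of 1

/-- The element `ab` of `G2`, which together with `b` generates `G2`. -/
def c : G2 := PresentedGroup.of 0 * PresentedGroup.of 1

/-- The element `c⁻²b`, whose image in the abelianization has order two. -/
def d : G2 := (c ^ 2)⁻¹ * b

lemma b_sq : b ^ 2 = c ^ 4 := by
  have h : PresentedGroup.mk rels2 (gb ^ 2 * ((ga * gb) ^ 4)⁻¹) = 1 :=
    PresentedGroup.one_of_mem (by simp [rels2])
  rw [map_mul, map_inv, mul_inv_eq_one, map_pow, map_pow, map_mul] at h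
  exact h

/-- Homomorphisms out of `G2` from images of `b` and `c`. -/
def lift {H : Type*} [Group H] (B C : H) (h : B ^ 2 = C ^ 4) : G2 →* H :=
  PresentedGroup.toGroup (f := ![C * B⁻¹, B]) (rels := rels2) (by
    rintro r rfl
    simp [ga, gb, h])

section lift

variable {H : Type*} [Group H] {B C : H} (h : B ^ 2 = C ^ 4)

@[simp] lemma lift_b : lift B C h b = B := by
  simp [lift, b]

@[simp] lemma lift_c : lift B C h c = C := by
  simp [lift, c]

@[simp] lemma lift_d : lift B C h d = (C ^ 2)⁻¹ * B := by
  simp [d]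

end lift

lemma eq_top_of_mem {S : Subgroup G2} (hb : b ∈ S) (hc : c ∈ S) : S = ⊤ := by
  rw [eq_top_iff, ← PresentedGroup.closure_range_of rels2, Subgroup.closure_le]
  rintro _ ⟨i, rfl⟩
  fin_cases i
  · simpa [b, c] using S.mul_mem hc (S.inv_mem hb)
  · exact hb

/-- The homomorphism onto `ℤ × ℤ/2ℤ` which turns out to be the abelianization. -/
def toAb : G2 →* Multiplicative (ℤ × ZMod 2) :=
  lift (.ofAdd (2, 1)) (.ofAdd (1, 0)) (by rw [← ofAdd_nsmul, ← ofAdd_nsmul]; decide)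

lemma toAb_d : toAb d = .ofAdd (0, 1) := by
  rw [toAb, lift_d, ← ofAdd_nsmul, ← ofAdd_neg, ← ofAdd_add]
  decide

lemma toAb_c_zpow (i : ℤ) : toAb (c ^ i) = .ofAdd (i, 0) := by
  rw [map_zpow, toAb, lift_c, ← ofAdd_zsmul]
  simp

/-- The embedding of the free group of rank three as the commutator subgroup. -/
def ofFree : FreeGroup (Fin 3) →* G2 :=
  FreeGroup.lift ![d * d, c⁻¹ * d * c * d, d⁻¹ * (c⁻¹ * d * c)]

lemma ofFree_mem_commutator (g : FreeGroup (Fin 3)) : ofFree g ∈ commutator G2 := by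
  rw [← Abelianization.ker_of, MonoidHom.mem_ker, ← MonoidHom.comp_apply]
  suffices Abelianization.of.comp ofFree = 1 by rw [this]; rfl
  have hd : Abelianization.of d * Abelianization.of d = 1 := by
    have h := congrArg Abelianization.of b_sq
    simp only [map_pow] at h
    simp only [d, map_mul, map_inv, map_pow]
    rw [mul_mul_mul_comm, ← pow_two (Abelianization.of b), h]
    group
  ext i
  fin_cases i
  · simpa [ofFree] using hd
  · simpa [ofFree, mul_comm, mul_assoc] using hd
  · simp [ofFree, mul_comm]

/-- Cosets of the two-element transversal `{1, d}` for the embedded free group. -/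
abbrev Sheet : Type := Bool × FreeGroup (Fin 3)

/-- The action of `d` on `Sheet`. -/
def dPerm : Perm Sheet where
  toFun p := if p.1 then (false, .of 0 * p.2) else (true, p.2)
  invFun p := if p.1 then (false, p.2) else (true, (.of 0)⁻¹ * p.2)
  left_inv := by rintro ⟨_ | _, g⟩ <;> simp
  right_inv := by rintro ⟨_ | _, g⟩ <;> simp

/-- The action of `c⁻¹dc` on `Sheet`. -/
def conjPerm : Perm Sheet where
  toFun p := if p.1 then (false, .of 1 * p.2) else (true, .of 2 * p.2)
  invFun p := if p.1 then (false, (.of 2)⁻¹ * p.2) else (true, (.of 1)⁻¹ * p.2)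
  left_inv := by rintro ⟨_ | _, g⟩ <;> simp
  right_inv := by rintro ⟨_ | _, g⟩ <;> simp

/-- The action of `c⁻ⁱdcⁱ` on `Sheet`. -/
def twist (i : ℤ) : Perm Sheet :=
  if i % 4 = 0 then dPerm else if i % 4 = 1 then conjPerm
  else if i % 4 = 2 then dPerm⁻¹ else conjPerm⁻¹

lemma twist_add_two (i : ℤ) : twist (i + 2) = (twist i)⁻¹ := by
  have h : i % 4 = 0 ∨ i % 4 = 1 ∨ i % 4 = 2 ∨ i % 4 = 3 := by omega
  rcases h with h | h | h | h <;> simp [twist, Int.add_emod, h]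

/-- The action of `b` on the normal forms `cⁱdᵉg`. -/
def bPerm : Perm (ℤ × Sheet) where
  toFun p := (p.1 + 2, twist p.1 p.2)
  invFun p := (p.1 - 2, twist p.1 p.2)
  left_inv p := by simp [twist_add_two]
  right_inv p := by
    have h := twist_add_two (p.1 - 2)
    rw [sub_add_cancel] at h
    simp [h]

/-- The action of `c` on the normal forms `cⁱdᵉg`. -/
def cPerm : Perm (ℤ × Sheet) := (Equiv.addRight 1).prodCongr (Equiv.refl _)

lemma cPerm_apply (p : ℤ × Sheet) : cPerm p = (p.1 + 1, p.2) := rfl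

lemma cPerm_symm_apply (p : ℤ × Sheet) : cPerm.symm p = (p.1 - 1, p.2) := rfl

lemma bPerm_apply (p : ℤ × Sheet) : bPerm p = (p.1 + 2, twist p.1 p.2) := rfl

lemma bPerm_sq : bPerm ^ 2 = cPerm ^ 4 := by
  ext1 p
  simp only [pow_succ, pow_zero, one_mul, Perm.mul_apply, bPerm_apply, cPerm_apply,
    twist_add_two, Perm.inv_def, symm_apply_apply]
  congr 1
  ring

/-- The action of `G2` on normal forms. -/
def act : G2 →* Perm (ℤ × Sheet) := lift bPerm cPerm bPerm_sq

lemma act_d (p : ℤ × Sheet) : act d p = (p.1, twist p.1 p.2) := by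
  simp [act, pow_two, bPerm_apply, cPerm_symm_apply]
  ring

lemma act_c (p : ℤ × Sheet) : act c p = (p.1 + 1, p.2) := by
  simp [act, cPerm_apply]

/-- The element `dᵉg` of `G2`. -/
def evalSheet (p : Sheet) : G2 := (if p.1 then d else 1) * ofFree p.2

/-- The element `cⁱdᵉg` of `G2`. -/
def eval (p : ℤ × Sheet) : G2 := c ^ p.1 * evalSheet p.2

lemma evalSheet_dPerm (p : Sheet) : evalSheet (dPerm p) = d * evalSheet p := by
  rcases p with ⟨_ | _, g⟩ <;> simp [evalSheet, dPerm, ofFree, mul_assoc]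

lemma evalSheet_conjPerm (p : Sheet) :
    evalSheet (conjPerm p) = c⁻¹ * d * c * evalSheet p := by
  rcases p with ⟨_ | _, g⟩ <;> simp [evalSheet, conjPerm, ofFree, mul_assoc]

lemma evalSheet_inv {σ : Perm Sheet} {g : G2} (h : ∀ p, evalSheet (σ p) = g * evalSheet p)
    (p : Sheet) : evalSheet (σ⁻¹ p) = g⁻¹ * evalSheet p := by
  rw [eq_inv_mul_iff_mul_eq, ← h, Perm.inv_def, apply_symm_apply]

lemma conj_sq_d : (c ^ 2)⁻¹ * d * c ^ 2 = d⁻¹ := by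
  rw [eq_inv_iff_mul_eq_one]
  have h : (c ^ 2)⁻¹ * d * c ^ 2 * d = (c ^ 4)⁻¹ * b ^ 2 := by
    simp only [d, pow_two b]; group
  rw [h, b_sq, inv_mul_cancel]

lemma conj_d_add_two (i : ℤ) : c ^ (-(i + 2)) * d * c ^ (i + 2) = (c ^ (-i) * d * c ^ i)⁻¹ := by
  calc c ^ (-(i + 2)) * d * c ^ (i + 2) = c ^ (-i) * ((c ^ 2)⁻¹ * d * c ^ 2) * c ^ i := by group
    _ = _ := by rw [conj_sq_d]; group

lemma evalSheet_twist (i : ℤ) (p : Sheet) :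
    evalSheet (twist i p) = c ^ (-i) * d * c ^ i * evalSheet p := by
  have up (i : ℤ) (h : ∀ p, evalSheet (twist i p) = c ^ (-i) * d * c ^ i * evalSheet p) (p) :
      evalSheet (twist (i + 2) p) = c ^ (-(i + 2)) * d * c ^ (i + 2) * evalSheet p := by
    rw [twist_add_two, conj_d_add_two, evalSheet_inv h]
  have down (i : ℤ)
      (h : ∀ p, evalSheet (twist (i + 2) p) = c ^ (-(i + 2)) * d * c ^ (i + 2) * evalSheet p)
      (p) : evalSheet (twist i p) = c ^ (-i) * d * c ^ i * evalSheet p := by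
    have := evalSheet_inv h p
    rwa [twist_add_two, conj_d_add_two, inv_inv, inv_inv] at this
  have step (r : ℤ) (h : ∀ p, evalSheet (twist r p) = c ^ (-r) * d * c ^ r * evalSheet p) (k : ℤ) :
      ∀ p, evalSheet (twist (r + 2 * k) p) =
        c ^ (-(r + 2 * k)) * d * c ^ (r + 2 * k) * evalSheet p := by
    induction k using Int.induction_on with
    | zero => simpa using h
    | succ k ih => rw [show r + 2 * ((k : ℤ) + 1) = r + 2 * k + 2 by ring]; exact up _ ih
    | pred k ih =>
      rw [show r + 2 * (-(k : ℤ)) = r + 2 * (-k - 1) + 2 by ring] at ih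
      exact down _ ih
  have key := step (i % 2) (by
    rcases Int.emod_two_eq_zero_or_one i with h | h <;> rw [h]
    · simpa [twist] using evalSheet_dPerm
    · simpa [twist] using evalSheet_conjPerm) (i / 2)
  rw [Int.emod_add_mul_ediv] at key
  exact key p

lemma eval_act (g : G2) (p : ℤ × Sheet) : eval (act g p) = g * eval p := by
  let S : Subgroup G2 :=
    { carrier := {g | ∀ p, eval (act g p) = g * eval p}
      one_mem' := by simp
      mul_mem' := fun {g h} hg hh p => by rw [map_mul, Perm.mul_apply, hg, hh, mul_assoc]
      inv_mem' := fun {g} hg p => by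
        rw [eq_inv_mul_iff_mul_eq, ← hg, map_inv, Perm.inv_def, apply_symm_apply] }
  have hS : S = ⊤ := by
    apply eq_top_of_mem
    · intro p
      have hb : b = c ^ 2 * d := by simp [d]
      simp only [act, lift_b, bPerm_apply, eval, evalSheet_twist]
      rw [hb]
      group
    · intro p
      simp only [act_c, eval]
      group
  exact (hS ▸ Subgroup.mem_top g : g ∈ S) p

lemma exists_eval_eq (g : G2) : ∃ p, eval p = g :=
  ⟨act g (0, false, 1), by rw [eval_act]; simp [eval, evalSheet]⟩

lemma act_inv_eq {g : G2} {p q : ℤ × Sheet} (h : act g p = q) : act g⁻¹ q = p := by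
  rw [map_inv, Perm.inv_eq_iff_eq, h]

lemma act_ofFree (h g : FreeGroup (Fin 3)) :
    act (ofFree h) (0, false, g) = (0, false, h * g) := by
  have hc (i : ℤ) (s : Sheet) : act c⁻¹ (i + 1, s) = (i, s) := act_inv_eq (act_c _)
  induction h using FreeGroup.induction_on generalizing g with
  | C1 => simp
  | of i =>
    have h1 (g) : act (c⁻¹ * d * c) (0, true, g) = (0, false, .of 1 * g) := by
      simp only [map_mul, Perm.mul_apply, act_c, act_d]
      rw [hc]; rfl
    have h2 (g) : act (c⁻¹ * d * c) (0, false, g) = (0, true, .of 2 * g) := by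
      simp only [map_mul, Perm.mul_apply, act_c, act_d]
      rw [hc]; rfl
    have hd (g) : act d (0, false, g) = (0, true, g) := act_d _
    have hd' (g) : act d (0, true, g) = (0, false, .of 0 * g) := act_d _
    rw [ofFree, FreeGroup.lift_apply_of]
    fin_cases i
    · change act (d * d) _ = _
      rw [map_mul, Perm.mul_apply, hd, hd']; rfl
    · change act (c⁻¹ * d * c * d) _ = _
      rw [map_mul, Perm.mul_apply, hd, h1]; rfl
    · change act (d⁻¹ * (c⁻¹ * d * c)) _ = _
      rw [map_mul, Perm.mul_apply, h2]
      exact act_inv_eq (hd _)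
  | inv_of i ih =>
    rw [map_inv]
    exact act_inv_eq (by rw [ih, mul_inv_cancel_left])
  | mul x y hx hy => rw [map_mul, map_mul, Perm.mul_apply, hy, hx, mul_assoc]

lemma ofFree_injective : Function.Injective ofFree := by
  intro g h hgh
  have := act_ofFree g 1
  rw [hgh, act_ofFree] at this
  simpa using this.symm

lemma commutator_le_ker : commutator G2 ≤ toAb.ker :=
  Abelianization.commutator_subset_ker toAb

lemma toAb_eval (p : ℤ × Sheet) : toAb (eval p) = .ofAdd (p.1, if p.2.1 then 1 else 0) := by
  have h : toAb (ofFree p.2.2) = 1 := commutator_le_ker (ofFree_mem_commutator _)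
  rw [eval, evalSheet, map_mul, map_mul, h, mul_one, toAb_c_zpow]
  split_ifs
  · rw [toAb_d, ← ofAdd_add]; simp
  · simp

lemma mem_range_ofFree_of_toAb_eq_one {g : G2} (hg : toAb g = 1) : g ∈ ofFree.range := by
  obtain ⟨⟨i, e, h⟩, rfl⟩ := exists_eval_eq g
  rw [toAb_eval, ofAdd_eq_one, Prod.mk_eq_zero] at hg
  obtain ⟨rfl, he⟩ := hg
  cases e
  · exact ⟨h, by simp [eval, evalSheet]⟩
  · simp at he

lemma range_ofFree : ofFree.range = commutator G2 :=
  le_antisymm (by rintro _ ⟨g, rfl⟩; exact ofFree_mem_commutator g)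
    fun _ hg => mem_range_ofFree_of_toAb_eq_one (commutator_le_ker hg)

lemma ker_toAb : toAb.ker = commutator G2 :=
  le_antisymm (fun _ hg => range_ofFree ▸ mem_range_ofFree_of_toAb_eq_one hg) commutator_le_ker

lemma toAb_surjective : Function.Surjective toAb := by
  intro x
  induction x with | ofAdd x
  obtain ⟨i, e⟩ := x
  refine ⟨eval (i, e = 1, 1), ?_⟩
  rw [toAb_eval]
  fin_cases e <;> rfl

end G2

/-- The commutator subgroup of G₂ = ⟨a, b | b² = (ab)⁴⟩ is isomorphic to the free group
on three generators; in particular G₂ is an extension of the free group of rank 3 by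
ℤ × ℤ/2ℤ (the quotient by the commutator subgroup being ℤ × ℤ/2ℤ). -/
theorem stmt_4 :
    Nonempty ((commutator G2) ≃* FreeGroup (Fin 3)) ∧
      Nonempty (Additive (Abelianization G2) ≃+ ℤ × ZMod 2) := by
  constructor
  · exact ⟨((MonoidHom.ofInjective G2.ofFree_injective).trans
      (MulEquiv.subgroupCongr G2.range_ofFree)).symm⟩
  · exact ⟨MulEquiv.toAdditiveLeft ((QuotientGroup.quotientMulEquivOfEq G2.ker_toAb.symm).trans
      (QuotientGroup.quotientKerEquivOfSurjective G2.toAb G2.toAb_surjective))⟩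
end
end
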